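/- (i) For 0 < τ < 1 define S₀(τ) := 2τ − τ·log(1 + 2τ) and S₁(τ) := (τ/6)·(1 − 1/(1 + 2τ)²); then S₀ is twice differentiable on (0,1) and S₁(τ) = −(1/6)·τ²·S₀''(τ) for all τ ∈ (0,1). (ii) For τ > 1 define S₀(τ) := 2 − τ·log((2τ + 1)/(2τ − 1)) and S₁(τ) := 4τ²/(3(4τ² − 1)²); then S₀ is twice differentiable on (1,∞) and S₁(τ) = −(1/6)·τ²·S₀''(τ) for all τ > 1. -/

import Mathlib

open Real

theorem aux_second_deriv {f g : ℝ → ℝ} {s : Set ℝ} (hs : IsOpen s)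
    (hf : ∀ x ∈ s, HasDerivAt f (g x) x) {x c : ℝ} (hx : x ∈ s) (hg : HasDerivAt g c x) :
    DifferentiableAt ℝ f x ∧ HasDerivAt (deriv f) c x := by
  refine ⟨(hf x hx).differentiableAt, hg.congr_of_eventuallyEq ?_⟩
  filter_upwards [hs.mem_nhds hx] with y hy
  exact (hf y hy).deriv

theorem aux_lin (a b x : ℝ) : HasDerivAt (fun t : ℝ => a * t + b) a x := by
  simpa using ((hasDerivAt_id x).const_mul a).add_const b

theorem aux_log1 {x : ℝ} (hx : 0 < x) :
    HasDerivAt (fun t : ℝ => Real.log (1 + 2 * t)) (2 / (1 + 2 * x)) x := by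
  have h : HasDerivAt (fun t : ℝ => 1 + 2 * t) 2 x := by
    simpa [add_comm] using aux_lin 2 1 x
  exact h.log (by positivity)

theorem aux_log2 {x : ℝ} (hx : 1 < x) :
    HasDerivAt (fun t : ℝ => Real.log ((2 * t + 1) / (2 * t - 1))) (-4 / (4 * x ^ 2 - 1)) x := by
  have h1 : 2 * x + 1 ≠ 0 := by linarith
  have h2 : 2 * x - 1 ≠ 0 := by linarith
  have h3 : 4 * x ^ 2 - 1 ≠ 0 := by nlinarith
  have h := ((aux_lin 2 1 x).div (aux_lin 2 (-1) x) (by simpa [sub_eq_add_neg] using h2)).log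
    (div_ne_zero h1 (by simpa [sub_eq_add_neg] using h2))
  simp only [← sub_eq_add_neg] at h
  refine h.congr_deriv ?_
  simp only [Pi.div_apply]
  rw [show 4 * x ^ 2 - 1 = (2 * x + 1) * (2 * x - 1) by ring]
  field_simp
  ring

/-- The differential relation `S₁(τ) = −(1/6)τ²S₀''(τ)` between the limiting bulk-scaled
structure function of the circular β-ensemble with β = 1 and the coefficient of `N⁻²` in
its large-`N` expansion, in the two regimes `0 < τ < 1` and `τ > 1`. -/
theorem coe_structure_function_correction_differential_relation :
    (∀ τ ∈ Set.Ioo (0 : ℝ) 1,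
      DifferentiableAt ℝ (fun t => 2 * t - t * Real.log (1 + 2 * t)) τ ∧
      DifferentiableAt ℝ (deriv fun t => 2 * t - t * Real.log (1 + 2 * t)) τ ∧
      (τ / 6) * (1 - 1 / (1 + 2 * τ) ^ 2) =
        -(1 / 6) * τ ^ 2 * deriv (deriv fun t => 2 * t - t * Real.log (1 + 2 * t)) τ) ∧
    (∀ τ ∈ Set.Ioi (1 : ℝ),
      DifferentiableAt ℝ (fun t => 2 - t * Real.log ((2 * t + 1) / (2 * t - 1))) τ ∧
      DifferentiableAt ℝ (deriv fun t => 2 - t * Real.log ((2 * t + 1) / (2 * t - 1))) τ ∧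
      4 * τ ^ 2 / (3 * (4 * τ ^ 2 - 1) ^ 2) =
        -(1 / 6) * τ ^ 2 *
          deriv (deriv fun t => 2 - t * Real.log ((2 * t + 1) / (2 * t - 1))) τ) := by
  constructor
  · intro τ hτ
    have h1 : 1 + 2 * τ ≠ 0 := by linarith [hτ.1]
    have key := aux_second_deriv (f := fun t => 2 * t - t * Real.log (1 + 2 * t))
      (g := fun t => 2 - (1 * Real.log (1 + 2 * t) + t * (2 / (1 + 2 * t))))
      (s := Set.Ioi 0) (c := -(4 + 4 * τ) / (1 + 2 * τ) ^ 2) isOpen_Ioi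
      (fun x hx => by
        have h2 : HasDerivAt (fun t : ℝ => 2 * t) 2 x := by simpa using aux_lin 2 0 x
        exact h2.sub ((hasDerivAt_id x).mul (aux_log1 hx)))
      (Set.mem_Ioi.2 hτ.1)
      (by
        have h2 : HasDerivAt (fun t : ℝ => 1 + 2 * t) 2 τ := by
          simpa [add_comm] using aux_lin 2 1 τ
        have h3 := (((aux_log1 hτ.1).const_mul 1).add
          ((hasDerivAt_id τ).mul ((hasDerivAt_const τ (2 : ℝ)).div h2 h1))).const_sub 2
        refine h3.congr_deriv ?_
        simp only [Pi.div_apply, id]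
        field_simp
        ring)
    refine ⟨key.1, key.2.differentiableAt, ?_⟩
    have e : 1 - 1 / (1 + 2 * τ) ^ 2 = (4 * τ + 4 * τ ^ 2) / (1 + 2 * τ) ^ 2 := by
      rw [eq_div_iff (pow_ne_zero 2 h1), sub_mul, one_div,
        inv_mul_cancel₀ (pow_ne_zero 2 h1)]
      ring
    rw [key.2.deriv, e]
    ring
  · intro τ hτ
    have hτ' : 1 < τ := hτ
    have h1 : 4 * τ ^ 2 - 1 ≠ 0 := by nlinarith
    have key := aux_second_deriv
      (f := fun t => 2 - t * Real.log ((2 * t + 1) / (2 * t - 1)))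
      (g := fun t => -(1 * Real.log ((2 * t + 1) / (2 * t - 1)) + t * (-4 / (4 * t ^ 2 - 1))))
      (s := Set.Ioi 1) (c := -8 / (4 * τ ^ 2 - 1) ^ 2) isOpen_Ioi
      (fun x hx => ((hasDerivAt_id x).mul (aux_log2 hx)).const_sub 2)
      hτ
      (by
        have h2 : HasDerivAt (fun t : ℝ => 4 * t ^ 2 - 1) (8 * τ) τ := by
          refine (((hasDerivAt_pow 2 τ).const_mul 4).sub_const 1).congr_deriv ?_
          norm_num
          ring
        have h3 := (((aux_log2 hτ').const_mul 1).add
          ((hasDerivAt_id τ).mul ((hasDerivAt_const τ (-4 : ℝ)).div h2 h1))).neg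
        refine h3.congr_deriv ?_
        simp only [Pi.div_apply, id]
        field_simp
        ring)
    refine ⟨key.1, key.2.differentiableAt, ?_⟩
    rw [key.2.deriv]
    field_simp
    ring
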